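/- Let q be an odd prime power with q ≡ 2 or 3 (mod 5), and let c ∈ F_{q^6} satisfy c^2 + c = 1. Suppose x ∈ F_{q^6} satisfies x ≠ 0, x ≠ c, (x^{q−1}·(x − c))^{q^2+q+1} = 1 and ( (c − x)^{−1} − x^{q^2} )^{(q^6−1)/(q+1)} = 1. Then there exists λ ∈ F_{q^6} with λ^{q^3} = λ, λ ≠ 0 and λ^{q^2+q+1} = 1 such that x·( λ^{q^2+q}·(c + 2) − λ^{q^2}·c + c ) = 2; in particular x = 2/( λ^{q^2+q}(c+2) − λ^{q^2}c + c ). -/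

import Mathlib

/-- A Frobenius-conjugate system attached to a root of `c ^ 2 + c = 1` has no solution; here
`u₀, …, u₅` play the role of the conjugates of an element and `c, d` of the conjugates of `c`. -/
lemma conjugate_system_unsolvable {F : Type*} [Field F] (h_two : (2 : F) ≠ 0) (h_five : (5 : F) ≠ 0)
    {c d : F} (hc : c ^ 2 + c = 1) (hd : d = -1 - c) {u₀ u₁ u₂ u₃ u₄ u₅ W₀ W₁ W₂ W₃ W₄ W₅ : F}
    (n₀ : u₀ ≠ 0) (n₁ : u₁ ≠ 0) (n₂ : u₂ ≠ 0) (n₃ : u₃ ≠ 0) (n₄ : u₄ ≠ 0) (n₅ : u₅ ≠ 0)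
    (w₀ : W₀ = 1 - c * u₀) (w₁ : W₁ = 1 - d * u₁) (w₂ : W₂ = 1 - c * u₂)
    (w₃ : W₃ = 1 - d * u₃) (w₄ : W₄ = 1 - c * u₄) (w₅ : W₅ = 1 - d * u₅)
    (e₀ : W₀ * W₁ * W₂ = u₁ * u₂ * u₃) (e₁ : W₁ * W₂ * W₃ = u₂ * u₃ * u₄)
    (e₂ : W₂ * W₃ * W₄ = u₃ * u₄ * u₅) (e₃ : W₃ * W₄ * W₅ = u₄ * u₅ * u₀)
    (hz : (u₀ / W₀ + 1 / u₂) * (u₂ / W₂ + 1 / u₄) * (u₄ / W₄ + 1 / u₀) =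
      (u₁ / W₁ + 1 / u₃) * (u₃ / W₃ + 1 / u₅) * (u₅ / W₅ + 1 / u₁)) : False := by
  have p₀ : W₀ * W₁ * W₂ ≠ 0 := by rw [e₀]; positivity
  have p₃ : W₃ * W₄ * W₅ ≠ 0 := by rw [e₃]; positivity
  simp only [ne_eq, mul_eq_zero, not_or] at p₀ p₃
  obtain ⟨⟨m₀, m₁⟩, m₂⟩ := p₀
  obtain ⟨⟨m₃, m₄⟩, m₅⟩ := p₃
  have a₀ : u₄ * W₀ = u₁ * W₃ := by
    have h : W₁ * W₂ * u₂ * u₃ ≠ 0 := by positivity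
    apply mul_left_cancel₀ h
    linear_combination u₂ * u₃ * u₄ * e₀ - u₁ * u₂ * u₃ * e₁
  have a₁ : u₅ * W₁ = u₂ * W₄ := by
    have h : W₂ * W₃ * u₃ * u₄ ≠ 0 := by positivity
    apply mul_left_cancel₀ h
    linear_combination u₃ * u₄ * u₅ * e₁ - u₂ * u₃ * u₄ * e₂
  have a₂ : u₀ * W₂ = u₃ * W₅ := by
    have h : W₃ * W₄ * u₄ * u₅ ≠ 0 := by positivity
    apply mul_left_cancel₀ h
    linear_combination u₄ * u₅ * u₀ * e₂ - u₃ * u₄ * u₅ * e₃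
  obtain ⟨v₀, hv₀⟩ : ∃ v, v = u₄ * W₀ := ⟨_, rfl⟩
  obtain ⟨v₁, hv₁⟩ : ∃ v, v = u₅ * W₁ := ⟨_, rfl⟩
  obtain ⟨v₂, hv₂⟩ : ∃ v, v = u₀ * W₂ := ⟨_, rfl⟩
  obtain ⟨P, hP⟩ : ∃ P, P = u₀ * u₂ * u₄ := ⟨_, rfl⟩
  obtain ⟨R, hR⟩ : ∃ R, R = u₁ * u₃ * u₅ := ⟨_, rfl⟩
  have P0 : P ≠ 0 := by rw [hP]; positivity
  have R0 : R ≠ 0 := by rw [hR]; positivity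
  have hn : v₀ * v₁ * v₂ = P * R := by
    rw [hv₀, hv₁, hv₂, hP, hR]; linear_combination u₄ * u₅ * u₀ * e₀
  have hWe : W₀ * W₂ * W₄ = R := by
    apply mul_left_cancel₀ P0
    rw [← hn, hv₀, hv₁, hv₂, hP]; linear_combination -u₄ * u₀ * W₀ * W₂ * a₁
  have hWo : W₁ * W₃ * W₅ = P := by
    apply mul_left_cancel₀ R0
    rw [mul_comm R P, ← hn, hv₀, hv₁, hv₂, hR, a₀, a₂]; ring
  have t₀ : c ^ 3 * P + R = 1 - c * (v₀ + v₁ + v₂) := by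
    rw [← hWe, hv₀, hv₁, hv₂, a₁, hP, w₀, w₂, w₄]; ring
  have t₁ : d ^ 3 * R + P = 1 - d * (v₀ + v₁ + v₂) := by
    rw [← hWo, hv₀, a₀, hv₁, hv₂, a₂, hR, w₁, w₃, w₅]; ring
  have hc3 : c ^ 3 = 2 * c - 1 := by linear_combination (c - 1) * hc
  have hd3 : d ^ 3 = -2 * c - 3 := by
    rw [hd]; linear_combination (-c - 2) * hc
  rw [hc3] at t₀
  rw [hd3, hd] at t₁
  have hsum : P + R = 3 - (v₀ + v₁ + v₂) := by
    apply mul_left_cancel₀ h_two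
    linear_combination (4 + 2 * c) * t₀ + (2 - 2 * c) * t₁ - 4 * (P + R + (v₀ + v₁ + v₂)) * hc
  have hdiff : P - R = 2 * c + 1 := by
    apply mul_left_cancel₀ h_two
    linear_combination (2 * c + 2) * t₀ + 2 * c * t₁ - 4 * (P - R) * hc
  have hPR : P - R ≠ 0 := by
    rw [hdiff]
    intro h
    apply h_five
    linear_combination (2 * c + 1) * h - 4 * hc
  have z₀ : u₀ / W₀ + 1 / u₂ = (P + v₀) / (u₂ * u₄ * W₀) := by
    rw [hP, hv₀]; field_simp
  have z₂ : u₂ / W₂ + 1 / u₄ = (P + v₂) / (u₄ * u₀ * W₂) := by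
    rw [hP, hv₂]; field_simp
  have z₄ : u₄ / W₄ + 1 / u₀ = (P + v₁) / (u₀ * u₂ * W₄) := by
    rw [hP, hv₁, a₁]; field_simp
  have z₁ : u₁ / W₁ + 1 / u₃ = (R + v₁) / (u₃ * u₅ * W₁) := by
    rw [hR, hv₁]; field_simp
  have z₃ : u₃ / W₃ + 1 / u₅ = (R + v₀) / (u₅ * u₁ * W₃) := by
    rw [hR, hv₀, a₀]; field_simp
  have z₅ : u₅ / W₅ + 1 / u₁ = (R + v₂) / (u₁ * u₃ * W₅) := by
    rw [hR, hv₂, a₂]; field_simp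
  have k₁ : u₂ * u₄ * W₀ * (u₄ * u₀ * W₂) * (u₀ * u₂ * W₄) = P ^ 2 * R := by
    rw [← hWe, hP]; ring
  have k₂ : u₃ * u₅ * W₁ * (u₅ * u₁ * W₃) * (u₁ * u₃ * W₅) = R ^ 2 * P := by
    rw [← hWo, hR]; ring
  rw [z₀, z₂, z₄, z₁, z₃, z₅, div_mul_div_comm, div_mul_div_comm, div_mul_div_comm,
    div_mul_div_comm, k₁, k₂, div_eq_div_iff (by positivity) (by positivity)] at hz
  have hfin : (P * R) ^ 2 * ((P - R) * 2) = 0 := by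
    linear_combination hz + P * R * (P - R) * hn - (P * R) ^ 2 * (P - R) * hsum
  have : (P * R) ^ 2 * ((P - R) * 2) ≠ 0 := by positivity
  exact this hfin

/-- In characteristic `p`, the Frobenius of `p ^ k ≡ ±2 (mod 5)` elements exchanges the two roots
of `X ^ 2 + X - 1`. -/
lemma pow_eq_neg_one_sub_of_sq_add_self {F : Type*} [Field F] (p k : ℕ) [Fact p.Prime] [CharP F p]
    (h : p ^ k % 5 = 2 ∨ p ^ k % 5 = 3) {c : F} (hc : c ^ 2 + c = 1) :
    c ^ p ^ k = -1 - c := by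
  let K := AlgebraicClosure F
  have : CharP K p := charP_of_injective_algebraMap (algebraMap F K).injective p
  apply (algebraMap F K).injective
  simp only [map_pow, map_sub, map_neg, map_one]
  have hC : (algebraMap F K c) ^ 2 + algebraMap F K c = 1 := by
    rw [← map_pow, ← map_add, hc, map_one]
  generalize algebraMap F K c = C at hC
  obtain ⟨z, w, hzw, hsum⟩ : ∃ z w : K, z * w = 1 ∧ z + w = C := by
    have hdeg : (Polynomial.X ^ 2 - Polynomial.C C * Polynomial.X + 1 : Polynomial K).degree = 2 := by
      compute_degree!
    obtain ⟨z, hz⟩ := IsAlgClosed.exists_root _ (hdeg.trans_ne two_ne_zero)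
    simp only [Polynomial.IsRoot.def, Polynomial.eval_add, Polynomial.eval_sub, Polynomial.eval_mul,
      Polynomial.eval_pow, Polynomial.eval_X, Polynomial.eval_C, Polynomial.eval_one] at hz
    exact ⟨z, C - z, by linear_combination -hz, by ring⟩
  have h5 : ∀ z w : K, z * w = 1 → z + w = C → z ^ 5 = 1 := by
    intro z w hzw hsum
    obtain rfl : w = C - z := by linear_combination hsum
    have h4 : z ^ 4 + z ^ 3 + z ^ 2 + z + 1 = 0 := by
      linear_combination (-(z ^ 2 + (1 + C) * z + 1)) * hzw + z ^ 2 * hC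
    linear_combination (z - 1) * h4
  have hz5 := h5 z w hzw hsum
  have hw5 := h5 w z (by rw [mul_comm, hzw]) (by rw [add_comm, hsum])
  have key : ∀ t : K, t ^ 5 = 1 → t ^ p ^ k = t ^ (p ^ k % 5) := by
    intro t ht
    conv_lhs => rw [← Nat.div_add_mod (p ^ k) 5, pow_add, pow_mul, ht, one_pow, one_mul]
  rw [← hsum, add_pow_char_pow, key z hz5, key w hw5]
  rw [← hsum] at hC
  rcases h with h | h <;> rw [h]
  · linear_combination hC - 2 * hzw
  · linear_combination (z + w - 1) * hC + (-3 * (z + w)) * hzw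

theorem stmt3 (q : ℕ) (hq : IsPrimePow q) (hodd : Odd q)
    (hq5 : q % 5 = 2 ∨ q % 5 = 3)
    (F : Type*) [Field F] [Fintype F] (hcard : Fintype.card F = q ^ 6)
    (c : F) (hc : c ^ 2 + c = 1)
    (x : F) (hx0 : x ≠ 0) (hxc : x ≠ c)
    (h1 : (x ^ (q - 1) * (x - c)) ^ (q ^ 2 + q + 1) = 1)
    (h2 : ((c - x)⁻¹ - x ^ (q ^ 2)) ^ ((q ^ 6 - 1) / (q + 1)) = 1) :
    ∃ l : F, l ^ (q ^ 3) = l ∧ l ≠ 0 ∧ l ^ (q ^ 2 + q + 1) = 1 ∧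
      x * (l ^ (q ^ 2 + q) * (c + 2) - l ^ (q ^ 2) * c + c) = 2 ∧
      x = 2 / (l ^ (q ^ 2 + q) * (c + 2) - l ^ (q ^ 2) * c + c) := by
  exfalso
  obtain ⟨p, k, hp, hk, hpq⟩ := (isPrimePow_nat_iff q).1 hq
  have : Fact p.Prime := ⟨hp⟩
  have : CharP F p := by
    obtain ⟨r, hr⟩ := CharP.exists F
    obtain ⟨n, hrp, hn⟩ := FiniteField.card F r
    have hdvd : r ∣ p ^ (k * 6) := by
      rw [pow_mul, hpq, ← hcard, hn]
      exact dvd_pow_self r n.ne_zero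
    obtain rfl := (Nat.prime_dvd_prime_iff_eq hrp hp).1 (hrp.dvd_of_dvd_pow hdvd)
    exact hr
  have prime_cast_ne : ∀ r : ℕ, r.Prime → ¬ r ∣ q → (r : F) ≠ 0 := by
    intro r hr hrq h0
    have := (Nat.prime_dvd_prime_iff_eq hp hr).1 ((CharP.cast_eq_zero_iff F p r).1 h0)
    subst this
    exact hrq (hpq ▸ dvd_pow_self p hk.ne')
  have h_two : (2 : F) ≠ 0 := by
    exact_mod_cast prime_cast_ne 2 Nat.prime_two (by rw [← even_iff_two_dvd]; simpa using hodd)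
  have h_five : (5 : F) ≠ 0 := by
    exact_mod_cast prime_cast_ne 5 Nat.prime_five (by omega)
  have hcq : c ^ q = -1 - c := by
    rw [← hpq] at hq5 ⊢
    exact pow_eq_neg_one_sub_of_sq_add_self p k hq5 hc
  obtain ⟨φ, hφ⟩ : ∃ φ : F →+* F, ∀ a, φ a = a ^ q :=
    ⟨iterateFrobenius F p k, fun a => by rw [iterateFrobenius_def, hpq]⟩
  have φc : φ c = -1 - c := by rw [hφ, hcq]
  have φd : φ (-1 - c) = c := by rw [map_sub, φc]; simp
  have hφ6 : ∀ a, φ (φ (φ (φ (φ (φ a))))) = a := by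
    intro a
    simp only [hφ, ← pow_mul]
    rw [show q * q * q * q * q * q = q ^ 6 by ring, ← hcard, FiniteField.pow_card]
  have hx3 : x ^ ((q - 1) * (q ^ 2 + q + 1)) * x = φ (φ (φ x)) := by
    have hq1 : 1 ≤ q := hq.pos
    simp only [hφ, ← pow_mul, ← pow_succ]
    congr 1
    obtain ⟨m, rfl⟩ := Nat.exists_eq_add_of_le' hq1
    simp only [Nat.add_sub_cancel]
    ring
  have hx2 : x ^ q ^ 2 = φ (φ x) := by simp only [hφ, ← pow_mul]; ring_nf
  have hy : ∀ y : F, y ^ ((q ^ 6 - 1) / (q + 1)) = 1 →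
      y * φ (φ y) * φ (φ (φ (φ y))) = φ y * φ (φ (φ y)) * φ (φ (φ (φ (φ y)))) := by
    intro y h
    have hE : (q ^ 6 - 1) / (q + 1) + (1 + q ^ 2 + q ^ 4) = q + q ^ 3 + q ^ 5 := by
      obtain ⟨m, rfl⟩ := Nat.exists_eq_add_of_le' hq.pos
      have : (m + 1) ^ 6 - 1 = m * ((m + 1) ^ 4 + (m + 1) ^ 2 + 1) * (m + 1 + 1) :=
        Nat.sub_eq_of_eq_add (by ring)
      rw [this, Nat.mul_div_cancel _ (Nat.succ_pos _)]
      ring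
    calc y * φ (φ y) * φ (φ (φ (φ y))) = y ^ (1 + q ^ 2 + q ^ 4) := by simp only [hφ]; ring
      _ = y ^ (q + q ^ 3 + q ^ 5) := by rw [← hE, pow_add y (_ / _), h, one_mul]
      _ = _ := by simp only [hφ]; ring
  have hE : φ (φ (φ x)) * ((x - c) * φ (x - c) * φ (φ (x - c))) = x := by
    have : (x - c) * φ (x - c) * φ (φ (x - c)) = (x - c) ^ (q ^ 2 + q + 1) := by
      simp only [hφ]; ring
    rw [this, ← hx3]
    rw [mul_pow, ← pow_mul] at h1
    linear_combination x * h1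
  rw [hx2] at h2
  have hz := hy _ h2
  obtain ⟨u, rfl⟩ : ∃ u : F, x = u⁻¹ := ⟨x⁻¹, by simp⟩
  have n₀ : u ≠ 0 := by simpa using hx0
  have hne : ∀ a : F, a ≠ 0 → φ a ≠ 0 := fun a ha => (map_ne_zero φ).2 ha
  have n₁ := hne _ n₀
  have n₂ := hne _ n₁
  have n₃ := hne _ n₂
  have n₄ := hne _ n₃
  have n₅ := hne _ n₄
  have e₀ : (1 - c * u) * (1 - (-1 - c) * φ u) * (1 - c * φ (φ u)) = φ u * φ (φ u) * φ (φ (φ u)) := by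
    simp only [map_sub, map_inv₀, φc, φd] at hE
    field_simp at hE
    linear_combination hE
  have e₁ := congrArg φ e₀
  simp only [map_mul, map_sub, map_one, φc, φd] at e₁
  have e₂ := congrArg φ e₁
  simp only [map_mul, map_sub, map_one, φc, φd] at e₂
  have e₃ := congrArg φ e₂
  simp only [map_mul, map_sub, map_one, φc, φd, hφ6] at e₃
  have inv_form : ∀ a b e : F, a ≠ 0 → (e - a⁻¹)⁻¹ - b⁻¹ = -(a / (1 - e * a) + 1 / b) := by
    intro a b e ha
    have : e - a⁻¹ = -((1 - e * a) / a) := by field_simp; ring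
    rw [this, inv_neg, inv_div]
    ring
  simp only [map_sub, map_inv₀, φc, φd, hφ6] at hz
  rw [inv_form _ _ _ n₀, inv_form _ _ _ n₁, inv_form _ _ _ n₂, inv_form _ _ _ n₃,
    inv_form _ _ _ n₄, inv_form _ _ _ n₅] at hz
  refine conjugate_system_unsolvable h_two h_five hc rfl n₀ n₁ n₂ n₃ n₄ n₅ rfl rfl rfl rfl rfl rfl
    e₀ ?_ ?_ ?_ ?_
  · linear_combination e₁
  · linear_combination e₂
  · linear_combination e₃
  · linear_combination -hz
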